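/- For all real P ≥ 2, all R with 2 ≤ R ≤ P, every q ∈ ℕ, every nonzero integer B, and all real γ, λ, one has Σ_{a=1}^{q} |h(B(a/q + γ) + λ; P,R)|⁴ ≤ q · card{ (x₁,x₂,x₃,x₄) ∈ 𝒜(P,R)⁴ : q divides B(x₁⁴ + x₂⁴ − x₃⁴ − x₄⁴) } ≤ |B|⁴ · (P/q + 1)⁴ · q · ρ(q). -/

import Mathlib

open scoped Real
open Filter MeasureTheory

noncomputable section

/-- `e(z) = exp(2πiz)`. -/
def e (z : ℝ) : ℂ := Complex.exp (2 * Real.pi * Complex.I * z)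

/-- The set `𝒜(P,R)` of `R`-smooth positive integers not exceeding `P`. -/
def smoothA (P R : ℝ) : Finset ℕ :=
  (Finset.Icc 1 ⌊P⌋₊).filter (fun n => ∀ p ∈ n.primeFactors, (p : ℝ) ≤ R)

/-- The smooth Weyl sum `h(α; P, R)`. -/
def h (P R α : ℝ) : ℂ := ∑ x ∈ smoothA P R, e (α * (x : ℝ) ^ 4)

/-- `Δ₇ = 0.849408`. -/
def Δ₇ : ℝ := 0.849408

/-- `Δ₁₀ = 0.213431`. -/
def Δ₁₀ : ℝ := 0.213431

/-- `ρ(q)`: the number of quadruples `1 ≤ x_i ≤ q` with `x₁⁴ + x₂⁴ ≡ x₃⁴ + x₄⁴ (mod q)`. -/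
def ρ (q : ℕ) : ℕ :=
  (((Finset.Icc 1 q ×ˢ Finset.Icc 1 q) ×ˢ (Finset.Icc 1 q ×ˢ Finset.Icc 1 q)).filter
    (fun x => x.1.1 ^ 4 + x.1.2 ^ 4 ≡ x.2.1 ^ 4 + x.2.2 ^ 4 [MOD q])).card

/-- The number of quadruples `x ∈ 𝒜(P,R)⁴` with `q ∣ B(x₁⁴ + x₂⁴ − x₃⁴ − x₄⁴)`. -/
def divCount (P R : ℝ) (q : ℕ) (B : ℤ) : ℕ :=
  ((((smoothA P R) ×ˢ (smoothA P R)) ×ˢ ((smoothA P R) ×ˢ (smoothA P R))).filter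
    (fun x => (q : ℤ) ∣ B * ((x.1.1 : ℤ) ^ 4 + (x.1.2 : ℤ) ^ 4
      - (x.2.1 : ℤ) ^ 4 - (x.2.2 : ℤ) ^ 4))).card

lemma e_add (x y : ℝ) : e (x + y) = e x * e y := by
  simp only [e, ← Complex.exp_add]
  push_cast
  ring_nf

lemma norm_e (x : ℝ) : ‖e x‖ = 1 := by
  have : (2 * Real.pi * Complex.I * x : ℂ) = ((2 * Real.pi * x : ℝ) : ℂ) * Complex.I := by
    push_cast
    ring
  rw [e, this, Complex.norm_exp_ofReal_mul_I]

lemma conj_e (x : ℝ) : (starRingEnd ℂ) (e x) = e (-x) := by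
  simp only [e, ← Complex.exp_conj]
  simp [map_ofNat (starRingEnd ℂ) 2]

lemma e_nat_mul (n : ℕ) (x : ℝ) : e (n * x) = e x ^ n := by
  simp only [e, ← Complex.exp_nat_mul]
  push_cast
  ring_nf

lemma e_eq_one_iff (x : ℝ) : e x = 1 ↔ ∃ n : ℤ, x = n := by
  rw [e, Complex.exp_eq_one_iff]
  have h2 : (2 * Real.pi * Complex.I : ℂ) ≠ 0 := Complex.two_pi_I_ne_zero
  refine exists_congr fun n => ?_
  rw [mul_comm, mul_left_inj' h2]
  norm_cast

/-- Additive characters modulo `q` sum to zero over a full period, unless they are trivial. -/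
lemma sum_e_mul_div_eq_zero {q : ℕ} (hq : q ≠ 0) {m : ℤ} (hm : ¬ (q : ℤ) ∣ m) :
    ∑ a ∈ Finset.Icc 1 q, e (a * ((m : ℝ) / q)) = 0 := by
  have hq' : (q : ℝ) ≠ 0 := by exact_mod_cast hq
  have hz : e ((m : ℝ) / q) ≠ 1 := by
    rw [Ne, e_eq_one_iff]
    rintro ⟨n, hn⟩
    rw [div_eq_iff hq'] at hn
    exact hm ⟨n, by rw [mul_comm]; exact_mod_cast hn⟩
  have hzq : e ((m : ℝ) / q) ^ q = 1 := by
    rw [← e_nat_mul, mul_div_cancel₀ _ hq', e_eq_one_iff]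
    exact ⟨m, rfl⟩
  simp only [e_nat_mul]
  have hIcc : Finset.Icc 1 q = Finset.Ico 1 (q + 1) := by
    ext
    simp only [Finset.mem_Icc, Finset.mem_Ico]
    omega
  rw [hIcc, geom_sum_Ico hz (by omega), pow_succ, hzq, one_mul, pow_one, sub_self, zero_div]

/-- The value `x₁⁴ + x₂⁴ - x₃⁴ - x₄⁴` at the quadruple `x`. -/
def quarticDiff (x : (ℕ × ℕ) × (ℕ × ℕ)) : ℤ :=
  (x.1.1 : ℤ) ^ 4 + (x.1.2 : ℤ) ^ 4 - (x.2.1 : ℤ) ^ 4 - (x.2.2 : ℤ) ^ 4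

lemma norm_h_pow_four (P R α : ℝ) :
    ((‖h P R α‖ ^ 4 : ℝ) : ℂ) =
      ∑ x ∈ (smoothA P R ×ˢ smoothA P R) ×ˢ (smoothA P R ×ˢ smoothA P R),
        e (α * quarticDiff x) := by
  have h1 : ((‖h P R α‖ ^ 4 : ℝ) : ℂ) =
      (h P R α * h P R α) * ((starRingEnd ℂ) (h P R α) * (starRingEnd ℂ) (h P R α)) := by
    have := Complex.mul_conj' (h P R α)
    push_cast
    linear_combination (-(h P R α * (starRingEnd ℂ) (h P R α)) - (‖h P R α‖ : ℂ) ^ 2) * this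
  rw [h1, h, map_sum, Finset.sum_mul_sum, Finset.sum_mul_sum, ← Finset.sum_product',
    ← Finset.sum_product', Finset.sum_mul_sum, ← Finset.sum_product']
  refine Finset.sum_congr rfl fun x _ => ?_
  rw [conj_e, conj_e, ← e_add, ← e_add, ← e_add]
  congr 1
  simp only [quarticDiff]
  push_cast
  ring

lemma sum_norm_h_pow_four_le (P R : ℝ) {q : ℕ} (hq : q ≠ 0) (B : ℤ) (γ lam : ℝ) :
    (∑ a ∈ Finset.Icc 1 q, ‖h P R ((B : ℝ) * ((a : ℝ) / (q : ℝ) + γ) + lam)‖ ^ 4)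
      ≤ (q : ℝ) * (divCount P R q B : ℝ) := by
  set T := (smoothA P R ×ˢ smoothA P R) ×ˢ (smoothA P R ×ˢ smoothA P R) with hT
  set F := ∑ a ∈ Finset.Icc 1 q, ‖h P R ((B : ℝ) * ((a : ℝ) / (q : ℝ) + γ) + lam)‖ ^ 4 with hF
  have hF0 : 0 ≤ F := Finset.sum_nonneg fun _ _ => by positivity
  have hsum : (F : ℂ) = ∑ x ∈ T, e ((B * γ + lam) * quarticDiff x) *
      ∑ a ∈ Finset.Icc 1 q, e (a * (((B * quarticDiff x : ℤ) : ℝ) / q)) := by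
    rw [hF, Complex.ofReal_sum]
    simp only [norm_h_pow_four, Finset.mul_sum]
    rw [Finset.sum_comm]
    refine Finset.sum_congr rfl fun x _ => Finset.sum_congr rfl fun a _ => ?_
    rw [← e_add]
    congr 1
    push_cast
    ring
  have hterm : ∀ x ∈ T, ‖e ((B * γ + lam) * quarticDiff x) *
      ∑ a ∈ Finset.Icc 1 q, e (a * (((B * quarticDiff x : ℤ) : ℝ) / q))‖ ≤
        if (q : ℤ) ∣ B * quarticDiff x then (q : ℝ) else 0 := by
    intro x _
    rw [norm_mul, norm_e, one_mul]
    split_ifs with hd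
    · refine (norm_sum_le _ _).trans ?_
      simp [norm_e]
    · rw [sum_e_mul_div_eq_zero hq hd, norm_zero]
  calc F = ‖(F : ℂ)‖ := by rw [Complex.norm_real, Real.norm_of_nonneg hF0]
    _ ≤ ∑ x ∈ T, if (q : ℤ) ∣ B * quarticDiff x then (q : ℝ) else 0 := by
      rw [hsum]
      exact (norm_sum_le _ _).trans (Finset.sum_le_sum hterm)
    _ = q * (divCount P R q B : ℝ) := by
      rw [← Finset.sum_filter, Finset.sum_const, nsmul_eq_mul, mul_comm]
      rfl

/-- Multiplying quadruples by `g` embeds the solutions modulo `r` into those modulo `g * r`. -/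
lemma ρ_le_ρ_mul {g : ℕ} (hg : g ≠ 0) (r : ℕ) : ρ r ≤ ρ (g * r) := by
  have hg' : 1 ≤ g := Nat.one_le_iff_ne_zero.mpr hg
  refine Finset.card_le_card_of_injOn
    (fun x => ((g * x.1.1, g * x.1.2), (g * x.2.1, g * x.2.2))) ?_ ?_
  · rintro ⟨⟨x₁, x₂⟩, ⟨x₃, x₄⟩⟩ hx
    simp only [Finset.coe_filter, Finset.mem_product, Finset.mem_Icc, Set.mem_ofPred_eq] at hx ⊢
    obtain ⟨⟨⟨⟨h1, h1'⟩, h2, h2'⟩, ⟨h3, h3'⟩, h4, h4'⟩, hmod⟩ := hx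
    refine ⟨⟨⟨⟨Nat.mul_pos hg' h1, Nat.mul_le_mul_left g h1'⟩,
      Nat.mul_pos hg' h2, Nat.mul_le_mul_left g h2'⟩,
      ⟨Nat.mul_pos hg' h3, Nat.mul_le_mul_left g h3'⟩,
      Nat.mul_pos hg' h4, Nat.mul_le_mul_left g h4'⟩, ?_⟩
    have := (Nat.ModEq.mul_left' g hmod).mul_left (g ^ 3)
    convert this using 1 <;> ring
  · rintro ⟨⟨x₁, x₂⟩, ⟨x₃, x₄⟩⟩ _ ⟨⟨y₁, y₂⟩, ⟨y₃, y₄⟩⟩ _ hxy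
    simpa [hg] using hxy

lemma dvd_of_mul_dvd_mul_of_coprime {g r b : ℕ} (hg : g ≠ 0) (hrb : r.Coprime b) {B N : ℤ}
    (hB : B.natAbs = g * b) (hd : ((g * r : ℕ) : ℤ) ∣ B * N) : (r : ℤ) ∣ N := by
  rw [Int.natCast_dvd, Int.natAbs_mul, hB, mul_assoc] at hd
  rw [Int.natCast_dvd]
  exact hrb.dvd_of_dvd_mul_left (Nat.dvd_of_mul_dvd_mul_left (Nat.pos_of_ne_zero hg) hd)

/-- The quadruples in `𝒜(P,R)⁴` solving the congruence modulo `r` number at most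
`(⌊P⌋ / r + 1)⁴` for each residue class of solutions. -/
lemma card_filter_dvd_quarticDiff_le (P R : ℝ) {r : ℕ} (hr : r ≠ 0) :
    (((smoothA P R ×ˢ smoothA P R) ×ˢ (smoothA P R ×ˢ smoothA P R)).filter
      (fun x => (r : ℤ) ∣ quarticDiff x)).card ≤ ρ r * (⌊P⌋₊ / r + 1) ^ 4 := by
  set K := Finset.range (⌊P⌋₊ / r + 1) with hK
  have hcard : ρ r * (⌊P⌋₊ / r + 1) ^ 4 =
      ((((Finset.Icc 1 r ×ˢ Finset.Icc 1 r) ×ˢ (Finset.Icc 1 r ×ˢ Finset.Icc 1 r)).filter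
        (fun x => x.1.1 ^ 4 + x.1.2 ^ 4 ≡ x.2.1 ^ 4 + x.2.2 ^ 4 [MOD r])) ×ˢ
        ((K ×ˢ K) ×ˢ (K ×ˢ K))).card := by
    simp only [Finset.card_product, hK, Finset.card_range, ρ]
    ring
  have hr0 : 0 < r := Nat.pos_of_ne_zero hr
  have hsm : ∀ x ∈ smoothA P R, 1 ≤ x ∧ (x - 1) / r < ⌊P⌋₊ / r + 1 := by
    intro x hx
    have := Finset.mem_Icc.mp (Finset.mem_filter.mp hx).1
    exact ⟨this.1, Nat.lt_succ_of_le (Nat.div_le_div_right (by omega))⟩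
  have hres : ∀ x, 1 ≤ (x - 1) % r + 1 ∧ (x - 1) % r + 1 ≤ r := fun x =>
    ⟨by omega, Nat.mod_lt _ hr0⟩
  have hmod : ∀ x, 1 ≤ x → (x - 1) % r + 1 ≡ x [MOD r] := by
    intro x hx
    have := (Nat.mod_modEq (x - 1) r).add_right 1
    rwa [Nat.sub_add_cancel hx] at this
  have hinj : ∀ x y, 1 ≤ x → 1 ≤ y → (x - 1) % r = (y - 1) % r → (x - 1) / r = (y - 1) / r →
      x = y := by
    intro x y hx hy h1 h2
    have h3 := Nat.div_add_mod (x - 1) r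
    have h4 := Nat.div_add_mod (y - 1) r
    rw [h1, h2, h4] at h3
    omega
  rw [hcard]
  refine Finset.card_le_card_of_injOn
    (fun x => ((((x.1.1 - 1) % r + 1, (x.1.2 - 1) % r + 1),
        ((x.2.1 - 1) % r + 1, (x.2.2 - 1) % r + 1)),
      (((x.1.1 - 1) / r, (x.1.2 - 1) / r), ((x.2.1 - 1) / r, (x.2.2 - 1) / r)))) ?_ ?_
  · rintro ⟨⟨x₁, x₂⟩, ⟨x₃, x₄⟩⟩ hx
    simp only [Finset.coe_filter, Finset.mem_product, Set.mem_ofPred_eq] at hx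
    obtain ⟨⟨⟨h1, h2⟩, h3, h4⟩, hd⟩ := hx
    simp only [Finset.mem_coe, Finset.mem_product, Finset.mem_filter, Finset.mem_Icc, hK,
      Finset.mem_range]
    refine ⟨⟨⟨⟨hres _, hres _⟩, hres _, hres _⟩, ?_⟩,
      ⟨(hsm _ h1).2, (hsm _ h2).2⟩, (hsm _ h3).2, (hsm _ h4).2⟩
    have hx34 : x₁ ^ 4 + x₂ ^ 4 ≡ x₃ ^ 4 + x₄ ^ 4 [MOD r] := by
      refine ((Nat.modEq_iff_dvd).mpr ?_).symm
      convert hd using 1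
      simp only [quarticDiff]
      push_cast
      ring
    exact ((((hmod _ (hsm _ h1).1).pow 4).add ((hmod _ (hsm _ h2).1).pow 4)).trans hx34).trans
      (((hmod _ (hsm _ h3).1).pow 4).add ((hmod _ (hsm _ h4).1).pow 4)).symm
  · rintro ⟨⟨x₁, x₂⟩, ⟨x₃, x₄⟩⟩ hx ⟨⟨y₁, y₂⟩, ⟨y₃, y₄⟩⟩ hy hxy
    simp only [Finset.coe_filter, Finset.mem_product, Set.mem_ofPred_eq] at hx hy
    obtain ⟨⟨⟨h1, h2⟩, h3, h4⟩, -⟩ := hx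
    obtain ⟨⟨⟨k1, k2⟩, k3, k4⟩, -⟩ := hy
    simp only [Prod.mk.injEq, Nat.add_right_cancel_iff] at hxy ⊢
    obtain ⟨⟨⟨m1, m2⟩, m3, m4⟩, ⟨d1, d2⟩, d3, d4⟩ := hxy
    exact ⟨⟨hinj _ _ (hsm _ h1).1 (hsm _ k1).1 m1 d1, hinj _ _ (hsm _ h2).1 (hsm _ k2).1 m2 d2⟩,
      hinj _ _ (hsm _ h3).1 (hsm _ k3).1 m3 d3, hinj _ _ (hsm _ h4).1 (hsm _ k4).1 m4 d4⟩

lemma divCount_le {P : ℝ} (hP : 0 ≤ P) (R : ℝ) {q : ℕ} (hq : q ≠ 0) {B : ℤ} (hB : B ≠ 0) :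
    (divCount P R q B : ℝ) ≤ |(B : ℝ)| ^ 4 * (P / q + 1) ^ 4 * ρ q := by
  obtain ⟨r, b, hrb, hqr, hBb⟩ := Nat.exists_coprime q B.natAbs
  set g := q.gcd B.natAbs with hgdef
  have hg : g ≠ 0 := (Nat.gcd_pos_of_pos_left _ (Nat.pos_of_ne_zero hq)).ne'
  have hr : r ≠ 0 := by
    rintro rfl
    simp at hqr
    exact hq hqr
  rw [mul_comm] at hqr hBb
  have hcount : divCount P R q B ≤ ρ q * (⌊P⌋₊ / r + 1) ^ 4 := by
    refine le_trans (Finset.card_le_card ?_) ((card_filter_dvd_quarticDiff_le P R hr).trans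
      (Nat.mul_le_mul_right _ ((ρ_le_ρ_mul hg r).trans_eq (congrArg ρ hqr.symm))))
    refine Finset.monotone_filter_right _ fun x _ hx => ?_
    rw [hqr] at hx
    exact dvd_of_mul_dvd_mul_of_coprime hg hrb hBb hx
  have hgB : (g : ℝ) ≤ |(B : ℝ)| := by
    rw [← Int.cast_abs, Int.abs_eq_natAbs, Int.cast_natCast, Nat.cast_le]
    exact Nat.gcd_le_right _ (Int.natAbs_pos.mpr hB)
  have hg1 : (1 : ℝ) ≤ g := by exact_mod_cast Nat.one_le_iff_ne_zero.mpr hg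
  have hr0 : (0 : ℝ) < r := by exact_mod_cast Nat.pos_of_ne_zero hr
  have hfib : ((⌊P⌋₊ / r : ℕ) : ℝ) + 1 ≤ |(B : ℝ)| * (P / q + 1) := by
    have h1 : ((⌊P⌋₊ / r : ℕ) : ℝ) ≤ P / r :=
      Nat.cast_div_le.trans (div_le_div_of_nonneg_right (Nat.floor_le hP) hr0.le)
    have h2 : P / r = g * (P / q) := by
      have hq' : (q : ℝ) = g * r := by exact_mod_cast hqr
      rw [hq']
      field_simp
    calc ((⌊P⌋₊ / r : ℕ) : ℝ) + 1 ≤ g * (P / q) + g := by rw [← h2]; gcongr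
      _ = g * (P / q + 1) := by ring
      _ ≤ |(B : ℝ)| * (P / q + 1) := by gcongr
  calc (divCount P R q B : ℝ) ≤ ρ q * (((⌊P⌋₊ / r : ℕ) : ℝ) + 1) ^ 4 := by exact_mod_cast hcount
    _ ≤ ρ q * (|(B : ℝ)| * (P / q + 1)) ^ 4 := by gcongr
    _ = |(B : ℝ)| ^ 4 * (P / q + 1) ^ 4 * ρ q := by ring

/-- `Σ_{a=1}^q |h(B(a/q + γ) + λ)|⁴` is at most `q` times the number of
quadruples in `𝒜(P,R)⁴` with `q ∣ B(x₁⁴+x₂⁴−x₃⁴−x₄⁴)`, which in turn is at most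
`|B|⁴·(P/q + 1)⁴·q·ρ(q)`. -/
theorem congruence_counting_bound (P R : ℝ) (hP : 2 ≤ P) (hR : 2 ≤ R) (hRP : R ≤ P)
    (q : ℕ) (hq : 1 ≤ q) (B : ℤ) (hB : B ≠ 0) (γ lam : ℝ) :
    (∑ a ∈ Finset.Icc 1 q,
        ‖h P R ((B : ℝ) * ((a : ℝ) / (q : ℝ) + γ) + lam)‖ ^ 4)
      ≤ (q : ℝ) * (divCount P R q B : ℝ) ∧
    (q : ℝ) * (divCount P R q B : ℝ)
      ≤ (|B| : ℝ) ^ 4 * (P / (q : ℝ) + 1) ^ 4 * (q : ℝ) * (ρ q : ℝ) := by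
  have hq0 : q ≠ 0 := Nat.one_le_iff_ne_zero.mp hq
  refine ⟨sum_norm_h_pow_four_le P R hq0 B γ lam, ?_⟩
  calc (q : ℝ) * (divCount P R q B : ℝ)
      ≤ q * (|(B : ℝ)| ^ 4 * (P / q + 1) ^ 4 * ρ q) := by
        gcongr
        exact divCount_le (by linarith) R hq0 hB
    _ = _ := by ring
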